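/- Let X be a compact Hausdorff space and let S ⊆ C(X) be a convex cone containing the constant functions. If φ is a lower semicontinuous function on X, then S(φ)(x) = inf{μ(φ) : μ ∈ J^S_x} for every x ∈ X, and the infimum is attained. -/

import Mathlib

open MeasureTheory Topology Filter Set
open scoped ENNReal Classical

noncomputable section

/-- A convex cone of continuous functions. -/
def IsConvexCone {X : Type*} [TopologicalSpace X] (S : Set C(X, ℝ)) : Prop :=
  (∀ u ∈ S, ∀ v ∈ S, u + v ∈ S) ∧ (∀ u ∈ S, ∀ c : ℝ, 0 ≤ c → c • u ∈ S)

/-- The `S`-Jensen measures at `x` on a compact space: regular Borel probability measures `μ`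
with `μ(φ) ≥ φ(x)` for all `φ ∈ S`. -/
def JensenMeasures {X : Type*} [TopologicalSpace X] [MeasurableSpace X]
    (S : Set C(X, ℝ)) (x : X) : Set (Measure X) :=
  {μ | IsProbabilityMeasure μ ∧ μ.Regular ∧ ∀ ψ ∈ S, ψ x ≤ ∫ y, ψ y ∂μ}

/-- The non-negative part of an extended real, as an extended non-negative real. -/
def erealToENNReal (x : EReal) : ℝ≥0∞ := if x = ⊤ then ⊤ else ENNReal.ofReal x.toReal

/-- The integral `μ(φ) ∈ [-∞, ∞]` of an `EReal`-valued function: the (extended) integral of the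
positive part minus the (extended) integral of the negative part. -/
def eInt {X : Type*} [MeasurableSpace X] (μ : Measure X) (φ : X → EReal) : EReal :=
  ((∫⁻ y, erealToENNReal (φ y) ∂μ : ℝ≥0∞) : EReal) -
    ((∫⁻ y, erealToENNReal (-(φ y)) ∂μ : ℝ≥0∞) : EReal)

/-- The `S`-envelope `S(φ)(x) = sup{u(x) : u ∈ S, u ≤ φ}` of an extended-real-valued function,
equal to `⊥ = -∞` if no `u ∈ S` lies below `φ`. -/
def SenvE {X : Type*} [TopologicalSpace X] (S : Set C(X, ℝ)) (φ : X → EReal) (x : X) : EReal :=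
  ⨆ u ∈ {u ∈ S | ∀ y, ((u y : ℝ) : EReal) ≤ φ y}, ((u x : ℝ) : EReal)

open scoped NNReal

lemma edw_functional {X : Type*} [TopologicalSpace X] [T2Space X] [CompactSpace X]
    (S : Set C(X, ℝ)) (hS : IsConvexCone S)
    (hconst : ∀ c : ℝ, ContinuousMap.const X c ∈ S)
    (φ : X → EReal) (x : X) (α : ℝ)
    (hα : ∀ u ∈ S, (∀ y, ((u y : ℝ) : EReal) ≤ φ y) → u x ≤ α) :
    ∃ L : C(X, ℝ) →ₗ[ℝ] ℝ, L 1 = 1 ∧ (∀ g, 0 ≤ g → 0 ≤ L g) ∧ (∀ u ∈ S, u x ≤ L u) ∧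
      ∀ h : C(X, ℝ), (∀ y, ((h y : ℝ) : EReal) ≤ φ y) → L h ≤ α := by
  obtain ⟨hadd, hsmul⟩ := hS
  have h0 : (0 : C(X, ℝ)) ∈ S := hconst 0
  let s : PointedCone ℝ C(X, ℝ) :=
    { carrier := {g | ∃ t : ℝ, 0 ≤ t ∧ ∃ u ∈ S, ∀ y,
        ((t * α + u y - u x - g y : ℝ) : EReal) ≤ (t : EReal) * φ y}
      zero_mem' := ⟨0, le_rfl, 0, h0, fun y => by simp⟩
      add_mem' := by
        rintro g₁ g₂ ⟨t₁, ht₁, u₁, hu₁, H₁⟩ ⟨t₂, ht₂, u₂, hu₂, H₂⟩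
        refine ⟨t₁ + t₂, by positivity, u₁ + u₂, hadd _ hu₁ _ hu₂, fun y => ?_⟩
        have := add_le_add (H₁ y) (H₂ y)
        rw [EReal.coe_add, EReal.right_distrib_of_nonneg (by exact_mod_cast ht₁) (by exact_mod_cast ht₂)]
        refine le_trans (le_of_eq ?_) this
        rw [← EReal.coe_add]
        congr 1
        simp only [ContinuousMap.add_apply]
        ring
      smul_mem' := by
        rintro ⟨c, hc⟩ g ⟨t, ht, u, hu, H⟩
        refine ⟨c * t, by positivity, c • u, hsmul _ hu _ hc, fun y => ?_⟩
        have := mul_le_mul_of_nonneg_left (H y) (show (0 : EReal) ≤ (c : EReal) by exact_mod_cast hc)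
        rw [← mul_assoc, ← EReal.coe_mul, ← EReal.coe_mul] at this
        refine le_trans (le_of_eq ?_) this
        congr 1
        have e : ((⟨c, hc⟩ : {c : ℝ // 0 ≤ c}) • g) y = c * g y := rfl
        rw [e]
        simp only [ContinuousMap.smul_apply, smul_eq_mul]
        ring }
  have hs : ∀ g, g ∈ s ↔ ∃ t : ℝ, 0 ≤ t ∧ ∃ u ∈ S, ∀ y,
        ((t * α + u y - u x - g y : ℝ) : EReal) ≤ (t : EReal) * φ y := fun g => Iff.rfl
  let ev : C(X, ℝ) →ₗ[ℝ] ℝ :=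
    { toFun := fun g => g x, map_add' := fun _ _ => rfl, map_smul' := fun _ _ => rfl }
  let f : C(X, ℝ) →ₗ.[ℝ] ℝ := ⟨Submodule.span ℝ {1}, ev.comp (Submodule.subtype _)⟩
  obtain ⟨L, hL1, hL2⟩ := riesz_extension s f (by
      rintro ⟨g, hg⟩ hgs
      obtain ⟨c, rfl⟩ := Submodule.mem_span_singleton.1 hg
      change 0 ≤ c * 1
      obtain ⟨t, ht, u, hu, H⟩ := (hs _).1 hgs
      rcases ht.eq_or_lt with rfl | ht
      · have := H x
        simp at this
        have h2 : 0 ≤ c := by exact_mod_cast this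
        linarith
      · have := hα (t⁻¹ • (u + ContinuousMap.const X (t * α - u x - c)))
          (hsmul _ (hadd _ hu _ (hconst _)) _ (by positivity)) (by
            intro y
            have h1 := mul_le_mul_of_nonneg_left (H y)
              (show (0 : EReal) ≤ ((t⁻¹ : ℝ) : EReal) by exact_mod_cast (by positivity))
            rw [← mul_assoc, ← EReal.coe_mul, ← EReal.coe_mul, inv_mul_cancel₀ ht.ne',
              EReal.coe_one, one_mul] at h1
            refine le_trans (le_of_eq ?_) h1
            congr 1
            simp
            ring)
        simp at this
        rw [← mul_add, inv_mul_le_iff₀ ht] at this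
        linarith) (by
      intro g
      refine ⟨⟨‖g‖ • 1, Submodule.mem_span_singleton.2 ⟨_, rfl⟩⟩, (hs _).2 ⟨0, le_rfl, 0, h0, ?_⟩⟩
      intro y
      have := neg_le_of_abs_le (g.norm_coe_le_norm y)
      simp
      have h2 : -g y + -‖g‖ ≤ 0 := by linarith
      exact_mod_cast h2)
  have hL1' : L 1 = 1 := hL1 ⟨1, Submodule.mem_span_singleton_self _⟩
  have hLc : ∀ c : ℝ, L (ContinuousMap.const X c) = c := by
    intro c
    have : ContinuousMap.const X c = c • (1 : C(X, ℝ)) := by ext; simp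
    rw [this, map_smul, hL1']; simp
  refine ⟨L, hL1', ?_, ?_, ?_⟩
  · intro g hg
    refine hL2 g ((hs _).2 ⟨0, le_rfl, 0, h0, fun y => ?_⟩)
    have : 0 ≤ g y := hg y
    simp
    exact_mod_cast this
  · intro u hu
    have := hL2 (u - ContinuousMap.const X (u x)) ((hs _).2 ⟨0, le_rfl, u, hu, fun y => by simp⟩)
    rw [map_sub, hLc] at this
    linarith
  · intro h hh
    have := hL2 (ContinuousMap.const X α - h) ((hs _).2 ⟨1, zero_le_one, 0, h0, fun y => by
      simpa using hh y⟩)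
    rw [map_sub, hLc] at this
    linarith

lemma edw_measure {X : Type*} [TopologicalSpace X] [T2Space X] [CompactSpace X]
    [MeasurableSpace X] [BorelSpace X]
    (S : Set C(X, ℝ)) (hS : IsConvexCone S)
    (hconst : ∀ c : ℝ, ContinuousMap.const X c ∈ S)
    (φ : X → EReal) (x : X) (α : ℝ)
    (hα : ∀ u ∈ S, (∀ y, ((u y : ℝ) : EReal) ≤ φ y) → u x ≤ α) :
    ∃ μ ∈ JensenMeasures S x,
      ∀ h : C(X, ℝ), (∀ y, ((h y : ℝ) : EReal) ≤ φ y) → ∫ y, h y ∂μ ≤ α := by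
  obtain ⟨L, h1, hpos, hJ, hle⟩ := edw_functional S hS hconst φ x α hα
  let Λ : CompactlySupportedContinuousMap X ℝ →ₚ[ℝ] ℝ := PositiveLinearMap.mk₀
    { toFun := fun g => L g.toContinuousMap
      map_add' := fun a b => L.map_add a.toContinuousMap b.toContinuousMap
      map_smul' := fun c a => L.map_smul c a.toContinuousMap }
    (fun g hg => hpos g.toContinuousMap hg)
  have hint : ∀ g : C(X, ℝ), ∫ y, g y ∂(RealRMK.rieszMeasure Λ) = L g := fun g =>
    RealRMK.integral_rieszMeasure Λ (CompactlySupportedContinuousMap.continuousMapEquiv g)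
  refine ⟨RealRMK.rieszMeasure Λ, ⟨⟨?_⟩, inferInstance, ?_⟩, ?_⟩
  · have := hint 1
    rw [h1] at this
    simp at this
    rw [Measure.real, ENNReal.toReal_eq_one_iff] at this
    exact this
  · intro ψ hψ
    rw [hint]; exact hJ ψ hψ
  · intro h hh
    rw [hint]; exact hle h hh

lemma edw_lsc {X : Type*} [TopologicalSpace X] [T2Space X] [CompactSpace X]
    [MeasurableSpace X] [BorelSpace X] (μ : Measure X) [IsProbabilityMeasure μ] [μ.Regular]
    (f : X → ℝ≥0∞) (hf : LowerSemicontinuous f) (β : ℝ≥0∞)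
    (H : ∀ h : C(X, ℝ≥0), (∀ y, (h y : ℝ≥0∞) ≤ f y) → ∫⁻ y, h y ∂μ ≤ β) :
    ∫⁻ y, f y ∂μ ≤ β := by
  have hU : ∀ q : ℝ≥0, IsOpen {y | (q : ℝ≥0∞) < f y} := fun q => hf.isOpen_preimage q
  have key : ∀ (q : ℚ) (j : ℕ), ∃ K : Set X, ∃ h : C(X, ℝ≥0),
      μ ({y | ((q : ℝ).toNNReal : ℝ≥0∞) < f y} \ K) < ((j : ℝ≥0∞) + 1)⁻¹ ∧
      (∀ y, (h y : ℝ≥0∞) ≤ f y) ∧ ∀ y ∈ K, h y = (q : ℝ).toNNReal := by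
    intro q j
    obtain ⟨K, hKU, hK, hμ⟩ := (hU (q : ℝ).toNNReal).measurableSet.exists_isCompact_sdiff_lt
      (measure_ne_top μ _) (ε := ((j : ℝ≥0∞) + 1)⁻¹) (by simp)
    obtain ⟨g, g0, g1, g01⟩ := exists_continuous_zero_one_of_isClosed
      (hU (q : ℝ).toNNReal).isClosed_compl hK.isClosed (disjoint_compl_left_iff_subset.mpr hKU)
    refine ⟨K, ⟨fun y => (q : ℝ).toNNReal * (g y).toNNReal, by fun_prop⟩, hμ, ?_, ?_⟩
    · intro y
      by_cases hy : ((q : ℝ).toNNReal : ℝ≥0∞) < f y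
      · refine le_trans ?_ hy.le
        have : (g y).toNNReal ≤ 1 := Real.toNNReal_le_one.2 (g01 y).2
        exact_mod_cast mul_le_of_le_one_right' this
      · have : g y = 0 := g0 hy
        simp [this]
    · intro y hy
      have : g y = 1 := g1 hy
      simp [this]
  choose K h hK hle hval using key
  -- finite suprema
  let G : Finset (ℚ × ℕ) → C(X, ℝ≥0) := fun F =>
    ⟨fun y => F.sup (fun p => h p.1 p.2 y), by
      exact Continuous.finset_sup_apply fun p _ => (h p.1 p.2).continuous⟩
  have hG : ∀ F y, G F y = F.sup (fun p => h p.1 p.2 y) := by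
    intro F y
    rfl
  have hGle : ∀ F y, (G F y : ℝ≥0∞) ≤ f y := by
    intro F y
    induction F using Finset.induction_on with
    | empty => simp [hG]
    | insert a F ha ih =>
      rw [hG, Finset.sup_insert, ← hG F y]; push_cast
      exact max_le (hle _ _ _) ih
  have hae : ∀ᵐ y ∂μ, ∀ q : ℚ, ((q : ℝ).toNNReal : ℝ≥0∞) < f y → ∃ j, y ∈ K q j := by
    rw [ae_all_iff]
    intro q
    rw [ae_iff]
    refine le_antisymm (ENNReal.le_of_forall_pos_le_add fun ε hε _ => ?_) (zero_le)
    obtain ⟨j, hj⟩ := ENNReal.exists_inv_nat_lt (a := (ε : ℝ≥0∞)) (by exact_mod_cast hε.ne')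
    rw [zero_add]
    calc _ ≤ μ ({y | ((q : ℝ).toNNReal : ℝ≥0∞) < f y} \ K q j) := by
          apply measure_mono
          intro y hy
          simp only [mem_ofPred_eq, Classical.not_imp, not_exists] at hy
          exact ⟨hy.1, hy.2 j⟩
      _ ≤ ((j : ℝ≥0∞) + 1)⁻¹ := (hK q j).le
      _ ≤ (j : ℝ≥0∞)⁻¹ := ENNReal.inv_le_inv.2 le_self_add
      _ ≤ ε := hj.le
  calc ∫⁻ y, f y ∂μ ≤ ∫⁻ y, ⨆ F, (G F y : ℝ≥0∞) ∂μ := by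
        apply lintegral_mono_ae
        filter_upwards [hae] with y hy
        refine le_of_forall_lt fun r hr => ?_
        obtain ⟨q, hq0, hrq, hqf⟩ := ENNReal.lt_iff_exists_rat_btwn.1 hr
        obtain ⟨j, hj⟩ := hy q hqf
        refine lt_of_lt_of_le hrq (le_trans ?_ (le_iSup (fun F => (G F y : ℝ≥0∞)) {(q, j)}))
        rw [hG]
        simp [hval q j y hj]
    _ = ⨆ F, ∫⁻ y, (G F y : ℝ≥0∞) ∂μ := by
        apply lintegral_iSup_directed
        · intro F
          exact (ENNReal.continuous_coe.comp (G F).continuous).measurable.aemeasurable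
        · apply Monotone.directed_le
          intro F₁ F₂ hF y
          have : G F₁ y ≤ G F₂ y := Finset.sup_mono hF
          exact ENNReal.coe_le_coe.2 this
    _ ≤ β := iSup_le fun F => H _ (hGle F)

lemma edw_toENNReal : erealToENNReal = EReal.toENNReal := by
  funext x; simp only [erealToENNReal, EReal.toENNReal]

lemma edw_shift (a : EReal) (M : ℝ≥0) (h : ((-(M : ℝ) : ℝ) : EReal) ≤ a) :
    erealToENNReal (-a) + erealToENNReal (a + (M : ℝ)) = erealToENNReal a + M ∧
      erealToENNReal (-a) ≤ M := by
  rw [edw_toENNReal]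
  induction a with
  | bot => exact absurd h (by simp)
  | top => simp
  | coe a =>
    have h : -(M : ℝ) ≤ a := by exact_mod_cast h
    rw [← EReal.coe_neg, ← EReal.coe_add]
    simp only [EReal.real_coe_toENNReal]
    have hM : (M : ℝ≥0∞) = ENNReal.ofReal M := by simp
    rw [hM]
    constructor
    · rcases le_total 0 a with ha | ha
      · rw [ENNReal.ofReal_of_nonpos (by linarith : -a ≤ 0), zero_add,
          ENNReal.ofReal_add ha M.coe_nonneg]
      · rw [ENNReal.ofReal_of_nonpos ha, zero_add,
          ← ENNReal.ofReal_add (by linarith) (by linarith)]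
        congr 1; ring
    · exact ENNReal.ofReal_le_ofReal (by linarith)

lemma edw_eInt {X : Type*} [MeasurableSpace X] (μ : Measure X) [IsProbabilityMeasure μ]
    (φ : X → EReal) (hφ : Measurable φ) (M : ℝ≥0) (h : ∀ y, ((-(M : ℝ) : ℝ) : EReal) ≤ φ y) :
    eInt μ φ = ((∫⁻ y, erealToENNReal (φ y + (M : ℝ)) ∂μ : ℝ≥0∞) : EReal) - ((M : ℝ) : EReal) := by
  have e : (∫⁻ y, erealToENNReal (-(φ y)) ∂μ) + ∫⁻ y, erealToENNReal (φ y + (M : ℝ)) ∂μ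
      = (∫⁻ y, erealToENNReal (φ y) ∂μ) + M := by
    rw [← lintegral_add_left]
    · simp_rw [fun y => (edw_shift (φ y) M (h y)).1]
      rw [lintegral_add_right _ measurable_const]
      simp
    · rw [edw_toENNReal]; fun_prop
  have hB : (∫⁻ y, erealToENNReal (-(φ y)) ∂μ) ≤ M := by
    calc _ ≤ ∫⁻ y, (M : ℝ≥0∞) ∂μ := lintegral_mono fun y => (edw_shift (φ y) M (h y)).2
      _ = M := by simp
  unfold eInt
  generalize (∫⁻ y, erealToENNReal (-(φ y)) ∂μ) = B at *
  generalize (∫⁻ y, erealToENNReal (φ y) ∂μ) = A at *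
  generalize (∫⁻ y, erealToENNReal (φ y + (M : ℝ)) ∂μ) = F at *
  lift B to ℝ≥0 using ne_top_of_le_ne_top ENNReal.coe_ne_top hB
  induction F with
  | top =>
    have : A = ⊤ := by
      by_contra hA
      lift A to ℝ≥0 using hA
      rw [add_top] at e
      exact ENNReal.coe_ne_top (r := A + M) (by rw [e]; simp)
    subst this
    rw [EReal.coe_ennreal_top, EReal.top_sub_coe]
    exact EReal.top_sub_coe B
  | coe F =>
    have hA : A ≠ ⊤ := by
      rintro rfl
      rw [top_add] at e
      exact ENNReal.coe_ne_top (r := B + F) (by rw [← e]; simp)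
    lift A to ℝ≥0 using hA
    have e' : B + F = A + M := by exact_mod_cast e
    have e'' : (B : ℝ) + F = A + M := by exact_mod_cast e'
    change (((A : ℝ) : EReal)) - ((B : ℝ) : EReal) = ((F : ℝ) : EReal) - ((M : ℝ) : EReal)
    rw [← EReal.coe_sub, ← EReal.coe_sub]
    congr 1
    linarith

lemma edw_easy {X : Type*} [TopologicalSpace X] [CompactSpace X]
    [MeasurableSpace X] [BorelSpace X] (μ : Measure X) [IsProbabilityMeasure μ]
    (φ : X → EReal) (hφ : Measurable φ) (u : C(X, ℝ)) (hu : ∀ y, ((u y : ℝ) : EReal) ≤ φ y) :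
    ((∫ y, u y ∂μ : ℝ) : EReal) ≤ eInt μ φ := by
  have hb : ∀ y, -(‖u‖₊ : ℝ) ≤ u y := fun y => neg_le_of_abs_le (u.norm_coe_le_norm y)
  have hi : Integrable u μ := u.continuous.integrable_of_hasCompactSupport
    (HasCompactSupport.of_compactSpace u)
  rw [edw_eInt μ φ hφ ‖u‖₊ (fun y => le_trans (by exact_mod_cast hb y) (hu y))]
  have h1 : ENNReal.ofReal (∫ y, (u y + (‖u‖₊ : ℝ)) ∂μ) ≤
      ∫⁻ y, erealToENNReal (φ y + (‖u‖₊ : ℝ)) ∂μ := by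
    rw [ofReal_integral_eq_lintegral_ofReal (f := fun y => u y + (‖u‖₊ : ℝ)) (hi.add (integrable_const _))
      (Eventually.of_forall fun y => by have := hb y; simp only [Pi.zero_apply]; linarith)]
    refine lintegral_mono fun y => ?_
    rw [edw_toENNReal, ← EReal.real_coe_toENNReal]
    apply EReal.toENNReal_le_toENNReal
    rw [EReal.coe_add]
    gcongr
    exact hu y
  have h2 := EReal.coe_ennreal_le_coe_ennreal_iff.2 h1
  rw [integral_add hi (integrable_const _)] at h2
  simp only [integral_const, probReal_univ, smul_eq_mul, one_mul] at h2
  rw [EReal.le_sub_iff_add_le (by simp) (by simp)]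
  refine le_trans ?_ h2
  rw [EReal.coe_ennreal_ofReal, ← EReal.coe_add]
  exact_mod_cast le_max_left _ _

/-- Theorem 1.1 (Edwards' Theorem): let `X` be a compact Hausdorff space, `S ⊆ C(X)` a convex
cone containing the constants, and `φ` a lower semicontinuous function on `X` (with values in
`(-∞, ∞]`). Then `S(φ)(x) = inf{μ(φ) : μ ∈ J^S_x}` for every `x`, and the infimum is
attained. -/
theorem edwards_theorem {X : Type*} [TopologicalSpace X] [T2Space X] [CompactSpace X]
    [MeasurableSpace X] [BorelSpace X]
    (S : Set C(X, ℝ)) (hS : IsConvexCone S)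
    (hconst : ∀ c : ℝ, ContinuousMap.const X c ∈ S)
    (φ : X → EReal) (hφ : LowerSemicontinuous φ) (hφbot : ∀ x : X, ⊥ < φ x) :
    ∀ x : X, SenvE S φ x = (⨅ μ ∈ JensenMeasures S x, eInt μ φ) ∧
      ∃ μ ∈ JensenMeasures S x, eInt μ φ = SenvE S φ x := by
  intro x
  have hm : Measurable φ := hφ.measurable
  have easy : ∀ μ ∈ JensenMeasures S x, SenvE S φ x ≤ eInt μ φ := by
    rintro μ ⟨hp, hr, hJ⟩
    refine iSup₂_le fun u hu => ?_
    exact le_trans (by exact_mod_cast hJ u hu.1) (edw_easy μ φ hm u hu.2)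
  suffices hex : ∃ μ ∈ JensenMeasures S x, eInt μ φ ≤ SenvE S φ x by
    obtain ⟨μ, hμ, hle⟩ := hex
    exact ⟨le_antisymm (le_iInf₂ easy) (iInf₂_le_of_le μ hμ hle), μ, hμ,
      le_antisymm hle (easy μ hμ)⟩
  -- lower bound of `φ`
  obtain ⟨M, hM⟩ : ∃ M : ℝ≥0, ∀ y, ((-(M : ℝ) : ℝ) : EReal) ≤ φ y := by
    obtain ⟨a, -, ha⟩ := LowerSemicontinuousOn.exists_isMinOn (s := univ) ⟨x, trivial⟩
      isCompact_univ (hφ.lowerSemicontinuousOn _)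
    obtain ⟨r, -, hr⟩ := EReal.lt_iff_exists_real_btwn.1 (hφbot a)
    refine ⟨(-r).toNNReal, fun y => le_trans ?_ (hr.le.trans (ha (mem_univ y)))⟩
    have : -((-r).toNNReal : ℝ) ≤ r := by
      have := Real.le_coe_toNNReal (-r)
      linarith
    exact_mod_cast this
  by_cases htop : SenvE S φ x = ⊤
  · obtain ⟨μ, hμ, -⟩ := edw_measure S hS hconst (fun _ => 0) x 0 (by
      intro u _ hu
      exact_mod_cast hu x)
    exact ⟨μ, hμ, by rw [htop]; exact le_top⟩
  have hMle : ((-(M : ℝ) : ℝ) : EReal) ≤ SenvE S φ x :=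
    le_iSup₂_of_le (f := fun (u : C(X, ℝ)) (_ : u ∈ {u ∈ S | ∀ y, ((u y : ℝ) : EReal) ≤ φ y}) =>
      ((u x : ℝ) : EReal)) (ContinuousMap.const X (-(M : ℝ))) ⟨hconst _, hM⟩ le_rfl
  have hbot : SenvE S φ x ≠ ⊥ := by
    intro h; rw [h] at hMle; simp at hMle
  obtain ⟨α, hα⟩ : ∃ α : ℝ, SenvE S φ x = α := ⟨_, (EReal.coe_toReal htop hbot).symm⟩
  have hMα : -(M : ℝ) ≤ α := by rw [hα] at hMle; exact_mod_cast hMle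
  obtain ⟨μ, hμ, hle⟩ := edw_measure S hS hconst φ x α (by
    intro u hu hle
    have : ((u x : ℝ) : EReal) ≤ SenvE S φ x :=
      le_iSup₂_of_le (f := fun (u : C(X, ℝ)) (_ : u ∈ {u ∈ S | ∀ y, ((u y : ℝ) : EReal) ≤ φ y}) =>
        ((u x : ℝ) : EReal)) u ⟨hu, hle⟩ le_rfl
    rw [hα] at this
    exact_mod_cast this)
  refine ⟨μ, hμ, ?_⟩
  obtain ⟨hp, hr, -⟩ := hμ
  rw [edw_eInt μ φ hm M hM, hα]
  have hnn : ∀ y, 0 ≤ φ y + ((M : ℝ) : EReal) := by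
    intro y
    have := add_le_add_left (hM y) ((M : ℝ) : EReal)
    refine le_trans (le_of_eq ?_) this
    rw [← EReal.coe_add]; simp
  have hlsc : LowerSemicontinuous (fun y => erealToENNReal (φ y + (M : ℝ))) := by
    intro y r hry
    have hry' : (r : EReal) - (M : ℝ) < φ y := by
      apply EReal.sub_lt_of_lt_add
      rw [← EReal.coe_toENNReal (hnn y), ← edw_toENNReal]
      exact EReal.coe_ennreal_lt_coe_ennreal_iff.2 hry
    filter_upwards [hφ y _ hry'] with z hz
    have : (r : EReal) < φ z + (M : ℝ) := (EReal.sub_lt_iff (.inl (by simp)) (.inl (by simp))).1 hz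
    rw [← EReal.coe_toENNReal (hnn z), ← edw_toENNReal] at this
    exact EReal.coe_ennreal_lt_coe_ennreal_iff.1 this
  have hF := edw_lsc μ _ hlsc (ENNReal.ofReal (α + M)) (by
    intro h hh
    let g : C(X, ℝ) := ⟨fun y => (h y : ℝ) - M, by fun_prop⟩
    have hc : Continuous (fun y => (h y : ℝ)) := by fun_prop
    have hi : Integrable (fun y => (h y : ℝ)) μ := hc.integrable_of_hasCompactSupport
      (HasCompactSupport.of_compactSpace _)
    have h1 := hle g (by
      intro y
      have := EReal.coe_ennreal_le_coe_ennreal_iff.2 (hh y)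
      rw [edw_toENNReal, EReal.coe_toENNReal (hnn y)] at this
      change (((h y : ℝ) - M : ℝ) : EReal) ≤ φ y
      rw [EReal.coe_sub]
      exact EReal.sub_le_of_le_add this)
    change ∫ y, ((h y : ℝ) - M) ∂μ ≤ α at h1
    rw [integral_sub hi (integrable_const _)] at h1
    simp only [integral_const, probReal_univ, smul_eq_mul, one_mul] at h1
    have h2 : ∫⁻ y, (h y : ℝ≥0∞) ∂μ = ENNReal.ofReal (∫ y, (h y : ℝ) ∂μ) := by
      rw [ofReal_integral_eq_lintegral_ofReal hi (Eventually.of_forall fun y => (h y).2)]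
      simp
    rw [h2]
    exact ENNReal.ofReal_le_ofReal (by linarith))
  have hF' := EReal.coe_ennreal_le_coe_ennreal_iff.2 hF
  rw [EReal.coe_ennreal_ofReal, max_eq_left (by linarith), EReal.coe_add] at hF'
  exact EReal.sub_le_of_le_add hF'
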